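/- There exists n_0 such that for all n ≥ n_0 the following holds: let N_1 and N_2 be Keith numbers with exactly n decimal digits and with N_1 = K^{N_1}_m and N_2 = K^{N_2}_m for the same index m, suppose each digit of N_1 is at most the corresponding digit of N_2 (componentwise in the n-tuples of digits), and suppose N_1 and N_2 have the same first ⌊n/2⌋ (most significant) digits. Then N_1 = N_2. -/

import Mathlib

/-- `keithList a m` is the list of the first `m` terms `K^N_1, …, K^N_m` of the Keith
sequence associated with the digit string `a = [a_1, …, a_n]` (most significant first):
`K^N_m = a_m` for `1 ≤ m ≤ n` and `K^N_m = K^N_{m-1} + ⋯ + K^N_{m-n}` for `m > n`. -/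
def keithList (a : List ℕ) : ℕ → List ℕ
  | 0 => []
  | m + 1 =>
      let prev := keithList a m
      prev ++ [if m < a.length then a.getD m 0 else (prev.drop (m - a.length)).sum]

/-- `keithSeq a m = K^N_m` (1-indexed; `keithSeq a 0 = 0` by convention). -/
def keithSeq (a : List ℕ) (m : ℕ) : ℕ := (keithList a m).getD (m - 1) 0

lemma keithList_length (a : List ℕ) (m : ℕ) : (keithList a m).length = m := by
  induction m with
  | zero => rfl
  | succ m ih => simp [keithList, ih]

lemma keithList_eq_map (a : List ℕ) (m : ℕ) :
    keithList a m = (List.range m).map fun i => keithSeq a (i + 1) := by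
  induction m with
  | zero => rfl
  | succ m ih =>
    rw [List.range_succ, List.map_append, ← ih]
    have h := keithList_length a m
    simp [keithSeq, keithList, h]

lemma keithSeq_succ_of_lt (a : List ℕ) {i : ℕ} (hi : i < a.length) :
    keithSeq a (i + 1) = a.getD i 0 := by
  have h := keithList_length a i
  simp [keithSeq, keithList, h, hi]

lemma keithSeq_add_length (a : List ℕ) (m : ℕ) :
    keithSeq a (m + a.length + 1) = ∑ j ∈ Finset.range a.length, keithSeq a (m + j + 1) := by
  have h := keithList_length a (m + a.length)
  have h₁ : keithSeq a (m + a.length + 1) =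
      ((keithList a (m + a.length)).drop m).sum := by
    simp [keithSeq, keithList, h]
  rw [h₁, keithList_eq_map, List.range_add, List.map_append, List.drop_left' (by simp),
    List.map_map, Finset.sum_range]
  rw [← List.sum_ofFn]
  congr 1
  apply List.ext_getElem <;> simp

section Recurrence

variable {n : ℕ} {f d : ℕ → ℤ}

lemma window_recurrence_double (hf : ∀ m, f (m + n) = ∑ j ∈ Finset.range n, f (m + j)) (m : ℕ) :
    f (m + 1 + n) + f m = 2 * f (m + n) := by
  have h₁ := Finset.sum_range_succ (fun j => f (m + j)) n
  have h₂ := Finset.sum_range_succ' (fun j => f (m + j)) n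
  have h₃ : ∑ j ∈ Finset.range n, f (m + (j + 1)) = f (m + 1 + n) := by
    rw [hf]
    exact Finset.sum_congr rfl fun j _ => by congr 1; ring
  have h₄ := hf m
  simp only [add_zero] at h₂
  linarith

lemma window_recurrence_nonneg (hf : ∀ m, f (m + n) = ∑ j ∈ Finset.range n, f (m + j))
    (h₀ : ∀ i < n, 0 ≤ f i) (m : ℕ) : 0 ≤ f m := by
  induction m using Nat.strong_induction_on with
  | _ m ih =>
    rcases lt_or_ge m n with h | h
    · exact h₀ m h
    · obtain ⟨k, rfl⟩ := Nat.exists_eq_add_of_le' h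
      rw [hf]
      exact Finset.sum_nonneg fun j hj => ih _ (by simpa using hj)

lemma window_recurrence_upper {c : ℤ}
    (hf : ∀ m, f (m + n) = ∑ j ∈ Finset.range n, f (m + j))
    (h₀ : ∀ i < n, 0 ≤ f i) (hc : ∀ i < n, f i ≤ c) (k : ℕ) :
    f (k + n) ≤ c * n * 2 ^ k := by
  induction k with
  | zero =>
    rw [hf]
    calc _ ≤ ∑ j ∈ Finset.range n, c :=
          Finset.sum_le_sum fun j hj => by simpa using hc j (by simpa using hj)
      _ = _ := by simp [mul_comm]
  | succ k ih =>
    have h₁ := window_recurrence_double hf k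
    have h₂ := window_recurrence_nonneg hf h₀ k
    rw [pow_succ]
    linarith

lemma window_recurrence_lower (hd : ∀ m, d (m + n) = ∑ j ∈ Finset.range n, d (m + j))
    (h₀ : ∀ i < n, 0 ≤ d i) (h₁ : 1 ≤ d n) {k : ℕ} (hk : k < n) :
    2 ^ k ≤ 2 * d (k + n) := by
  have key : ∀ k < n, ∑ j ∈ Finset.range k, d (j + n) ≤ d (k + n) := by
    intro k hk
    obtain ⟨l, rfl⟩ := Nat.exists_eq_add_of_le' hk.le
    rw [hd, Finset.sum_range_add]
    have h₂ : 0 ≤ ∑ j ∈ Finset.range l, d (k + j) :=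
      Finset.sum_nonneg fun j _ => window_recurrence_nonneg hd h₀ _
    have h₃ : ∑ j ∈ Finset.range k, d (j + (l + k)) = ∑ j ∈ Finset.range k, d (k + (l + j)) :=
      Finset.sum_congr rfl fun j _ => by congr 1; ring
    linarith
  have sum_ge : ∀ k < n, 2 ^ k ≤ ∑ j ∈ Finset.range (k + 1), d (j + n) := by
    intro k
    induction k with
    | zero => simpa using fun _ => h₁
    | succ k ih =>
      intro hk
      have h₂ := key (k + 1) hk
      have h₃ := ih (by omega)
      rw [Finset.sum_range_succ, pow_succ]
      linarith
  have h₂ := sum_ge k hk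
  rw [Finset.sum_range_succ] at h₂
  linarith [key k hk]

lemma window_recurrence_compare {c : ℤ} (hc₀ : 0 ≤ c)
    (hf : ∀ m, f (m + n) = ∑ j ∈ Finset.range n, f (m + j))
    (hf₀ : ∀ i < n, 0 ≤ f i) (hc : ∀ i < n, f i ≤ c)
    (hd : ∀ m, d (m + n) = ∑ j ∈ Finset.range n, d (m + j))
    (hd₀ : ∀ i < n, 0 ≤ d i) (hd₁ : 1 ≤ d n) (k : ℕ) :
    f (k + n) ≤ 2 * c * n * d (k + n) := by
  induction k using Nat.strong_induction_on with
  | _ k ih =>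
    rcases lt_or_ge k n with h | h
    · calc f (k + n) ≤ c * n * 2 ^ k := window_recurrence_upper hf hf₀ hc k
        _ ≤ c * n * (2 * d (k + n)) := by
          gcongr
          exact window_recurrence_lower hd hd₀ hd₁ h
        _ = _ := by ring
    · obtain ⟨l, rfl⟩ := Nat.exists_eq_add_of_le' h
      rw [hf, hd, Finset.mul_sum]
      refine Finset.sum_le_sum fun j hj => ?_
      rw [add_right_comm]
      exact ih _ (by simpa using hj)

end Recurrence

lemma linear_lt_ten_pow (t : ℕ) (ht : 5 ≤ t) : 180 * (2 * t + 1) < 10 ^ t := by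
  induction t, ht using Nat.le_induction with
  | base => norm_num
  | succ t _ ih => rw [pow_succ]; omega

lemma sub_lt_of_leading_digits_eq {n k N₁ N₂ : ℕ}
    (h₁ : (Nat.digits 10 N₁).length = n) (h₂ : (Nat.digits 10 N₂).length = n)
    (h : (Nat.digits 10 N₁).reverse.take k = (Nat.digits 10 N₂).reverse.take k) :
    (N₂ : ℤ) - N₁ < 10 ^ (n - k) := by
  rw [List.take_reverse, List.take_reverse, h₁, h₂, List.reverse_inj] at h
  have hdiv : N₁ / 10 ^ (n - k) = N₂ / 10 ^ (n - k) := by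
    rw [Nat.self_div_pow_eq_ofDigits_drop _ _ (by norm_num),
      Nat.self_div_pow_eq_ofDigits_drop _ _ (by norm_num), h]
  have e₁ := Nat.div_add_mod N₁ (10 ^ (n - k))
  have e₂ := Nat.div_add_mod N₂ (10 ^ (n - k))
  have hlt := Nat.mod_lt N₂ (show 10 ^ (n - k) > 0 by positivity)
  rw [hdiv] at e₁
  have : N₂ < N₁ + 10 ^ (n - k) := by omega
  zify at this
  linarith


/-- For all large n: two Keith numbers with exactly n decimal digits, appearing in their
own Keith sequences at the same index m, whose digit tuples are comparable componentwise
and which share the first ⌊n/2⌋ most significant digits, must be equal. -/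
theorem keith_block_antichain :
    ∃ n₀ : ℕ, ∀ n, n₀ ≤ n → ∀ N₁ N₂ m : ℕ,
      (Nat.digits 10 N₁).length = n → (Nat.digits 10 N₂).length = n →
      1 ≤ m →
      keithSeq ((Nat.digits 10 N₁).reverse) m = N₁ →
      keithSeq ((Nat.digits 10 N₂).reverse) m = N₂ →
      List.Forall₂ (· ≤ ·) (Nat.digits 10 N₁) (Nat.digits 10 N₂) →
      (Nat.digits 10 N₁).reverse.take (n / 2) = (Nat.digits 10 N₂).reverse.take (n / 2) →
      N₁ = N₂ := by
  refine ⟨10, fun n hn N₁ N₂ m h₁ h₂ hm hK₁ hK₂ hle htop => ?_⟩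
  by_contra hne
  set a := (Nat.digits 10 N₁).reverse with ha
  set b := (Nat.digits 10 N₂).reverse with hb
  have la : a.length = n := by simp [ha, h₁]
  have lb : b.length = n := by simp [hb, h₂]
  have hdig : ∀ i < n, keithSeq a (i + 1) ≤ 9 := by
    intro i hi
    have hia : i < a.length := by omega
    rw [keithSeq_succ_of_lt a hia, List.getD_eq_getElem _ _ hia]
    have hmem : a[i] ∈ Nat.digits 10 N₁ := by
      rw [← List.mem_reverse]
      exact List.getElem_mem _
    have := Nat.digits_lt_base (by norm_num) hmem
    omega
  have hab : List.Forall₂ (· ≤ ·) a b := List.rel_reverse hle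
  have hmono : ∀ i < n, keithSeq a (i + 1) ≤ keithSeq b (i + 1) := by
    intro i hi
    have hia : i < a.length := by omega
    have hib : i < b.length := by omega
    rw [keithSeq_succ_of_lt a hia, List.getD_eq_getElem _ _ hia,
      keithSeq_succ_of_lt b hib, List.getD_eq_getElem _ _ hib]
    exact hab.get hia hib
  have hN₁ : 10 ^ n ≤ 10 * N₁ := by
    rw [← h₁]
    refine Nat.base_pow_length_digits_le 10 N₁ (by norm_num) ?_
    rintro rfl
    simp at h₁
    omega
  have hnm : n < m := by
    by_contra! hmn
    have h := hdig (m - 1) (by omega)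
    rw [Nat.sub_add_cancel hm, hK₁] at h
    have : 10 ^ 10 ≤ 10 ^ n := Nat.pow_le_pow_right (by norm_num) hn
    omega
  set f : ℕ → ℤ := fun i => keithSeq a (i + 1) with hf
  set d : ℕ → ℤ := fun i => keithSeq b (i + 1) - keithSeq a (i + 1) with hd
  have frec : ∀ m, f (m + n) = ∑ j ∈ Finset.range n, f (m + j) := fun m => by
    simp only [hf, ← la, keithSeq_add_length, Nat.cast_sum]
  have drec : ∀ m, d (m + n) = ∑ j ∈ Finset.range n, d (m + j) := fun m => by
    have ha' := keithSeq_add_length a m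
    have hb' := keithSeq_add_length b m
    rw [la] at ha'
    rw [lb] at hb'
    simp only [hd, Finset.sum_sub_distrib, ha', hb', Nat.cast_sum]
  have d₀ : ∀ i < n, 0 ≤ d i := fun i hi => by
    have := hmono i hi
    simp only [hd]
    omega
  have d₁ : 1 ≤ d n := by
    by_contra! hlt
    have hsum : d n = ∑ j ∈ Finset.range n, d j := by simpa using drec 0
    have hzero : ∑ j ∈ Finset.range n, d j = 0 := by
      have := Finset.sum_nonneg fun j hj => d₀ j (Finset.mem_range.1 hj)
      omega
    rw [Finset.sum_eq_zero_iff_of_nonneg fun j hj => d₀ j (Finset.mem_range.1 hj)] at hzero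
    apply hne
    apply Nat.digits_inj_iff.1
    apply List.reverse_injective
    refine List.ext_getElem (la.trans lb.symm) fun i hia hib => ?_
    have h := hzero i (Finset.mem_range.2 (hia.trans_eq la))
    simp only [hd] at h
    rw [keithSeq_succ_of_lt a hia, List.getD_eq_getElem _ _ hia,
      keithSeq_succ_of_lt b hib, List.getD_eq_getElem _ _ hib] at h
    omega
  have hcmp := window_recurrence_compare (c := 9) (by norm_num) frec (fun i _ => by simp [hf])
    (fun i hi => by simpa [hf] using Nat.cast_le (α := ℤ).2 (hdig i hi)) drec d₀ d₁ (m - 1 - n)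
  rw [Nat.sub_add_cancel (by omega)] at hcmp
  simp only [hf, hd, Nat.sub_add_cancel hm, hK₁, hK₂] at hcmp
  have hgap := sub_lt_of_leading_digits_eq h₁ h₂ htop
  have hpow : (10 : ℤ) ^ n = 10 ^ (n / 2) * 10 ^ (n - n / 2) := by
    rw [← pow_add]
    congr 1
    omega
  have hbig : 180 * (n : ℤ) < 10 ^ (n / 2) := by
    have := linear_lt_ten_pow (n / 2) (by omega)
    have : 180 * n < 10 ^ (n / 2) := by omega
    exact_mod_cast this
  have hN₁' : (10 : ℤ) ^ n ≤ 10 * N₁ := by exact_mod_cast hN₁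
  have hchain : (180 * n : ℤ) * (N₂ - N₁) ≤ 180 * n * 10 ^ (n - n / 2) := by gcongr
  have hchain' : (180 * n : ℤ) * 10 ^ (n - n / 2) < 10 ^ (n / 2) * 10 ^ (n - n / 2) := by gcongr
  linarith
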